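/- Let P ⊂ ℝ^n be an n-dimensional lattice simplex with vertices v_0, …, v_n. Then c(P) = (n+1)·s_{{0,…,n}} + Σ_{I ⊆ {0,…,n}, |I| = n} s_I. In particular, c(P) = 0 if and only if s_I = 0 for every I ⊆ {0,…,n} with |I| ≥ n. -/

import Mathlib

open scoped Pointwise
open MeasureTheory

noncomputable section

/-- The image of an integer point under the coercion `ℤ → ℝ` (a lattice point). -/
def latt {ι : Type*} (x : ι → ℤ) : ι → ℝ := fun i => (x i : ℝ)

/-- `F` is a (nonempty, exposed) face of `P` of dimension `j`. -/
def IsFaceOfDim {n : ℕ} (P F : Set (Fin n → ℝ)) (j : ℕ) : Prop :=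
  F.Nonempty ∧ IsExposed ℝ P F ∧ Module.finrank ℝ (affineSpan ℝ F).direction = j

/-- `φ : ℝ^j → ℝ^n` is an affine parametrization of the affine hull of `F` mapping the
lattice `ℤ^j` bijectively onto `aff(F) ∩ ℤ^n`.  Pulling `F` back by such a `φ` computes
volumes with respect to the lattice `aff(F) ∩ ℤ^n`. -/
def IsUnimodularParam {n j : ℕ} (F : Set (Fin n → ℝ))
    (φ : (Fin j → ℝ) →ᵃ[ℝ] (Fin n → ℝ)) : Prop :=
  Function.Injective φ ∧
    Set.range φ = (affineSpan ℝ F : Set (Fin n → ℝ)) ∧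
    ∀ x : Fin j → ℝ, (∃ w : Fin j → ℤ, x = latt w) ↔ ∃ z : Fin n → ℤ, φ x = latt z

/-- The lifted vertex `(v_i, 1) ∈ ℝ^n × ℝ = ℝ^{n+1}`. -/
def vhat {n : ℕ} (v : Fin (n + 1) → Fin n → ℤ) (i : Fin (n + 1)) : Fin (n + 1) → ℝ :=
  Fin.snoc (latt (v i)) 1

/-- For `I ⊆ {0, …, n}`, the number `s_I` of points `x ∈ ℤ^{n+1}` of the form
`x = ∑_{i ∈ I} λ_i (v_i, 1)` with `0 < λ_i < 1` for all `i ∈ I`.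
(For `I = ∅` this set is `{0}`, so `s_∅ = 1`.) -/
def sI {n : ℕ} (v : Fin (n + 1) → Fin n → ℤ) (I : Finset (Fin (n + 1))) : ℕ :=
  Set.ncard {x : Fin (n + 1) → ℤ | ∃ lam : Fin (n + 1) → ℝ,
    (∀ i ∈ I, 0 < lam i ∧ lam i < 1) ∧ latt x = ∑ i ∈ I, lam i • vhat v i}

/-- The simplex in `ℝ^n` cut off from the nonnegative orthant by `∑ i, x i ≤ s`. -/
def cornerSimplex (n : ℕ) (s : ℝ) : Set (Fin n → ℝ) := {x | (∀ i, 0 ≤ x i) ∧ ∑ i, x i ≤ s}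

lemma volume_cornerSimplex (n : ℕ) {s : ℝ} (hs : 0 ≤ s) :
    volume (cornerSimplex n s) = ENNReal.ofReal (s ^ n / n.factorial) := by
  induction n generalizing s with
  | zero =>
    have : cornerSimplex 0 s = Set.univ := by
      ext x; simp [cornerSimplex, hs]
    simp [this, volume_pi]
  | succ n ih =>
    have hmp := (volume_preserving_piFinSuccAbove (fun _ : Fin (n + 1) => ℝ) 0)
    let T : Set (ℝ × (Fin n → ℝ)) := {p | 0 ≤ p.1 ∧ p.2 ∈ cornerSimplex n (s - p.1)}
    have hT : MeasurableSet T := by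
      have : T = {p | 0 ≤ p.1} ∩ (⋂ i, {p | 0 ≤ p.2 i}) ∩ {p | p.1 + ∑ i, p.2 i ≤ s} := by
        ext p
        simp only [T, cornerSimplex, Set.mem_ofPred_eq, Set.mem_inter_iff, Set.mem_iInter,
          le_sub_iff_add_le', and_assoc]
      rw [this]
      refine IsClosed.measurableSet ?_
      refine ((isClosed_le (by fun_prop) (by fun_prop)).inter
        (isClosed_iInter fun i => isClosed_le (by fun_prop) (by fun_prop))).inter
        (isClosed_le (by fun_prop) (by fun_prop))
    have hpre : (MeasurableEquiv.piFinSuccAbove (fun _ : Fin (n + 1) => ℝ) 0) ⁻¹' T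
        = cornerSimplex (n + 1) s := by
      ext x
      simp [T, cornerSimplex, MeasurableEquiv.piFinSuccAbove, Fin.forall_fin_succ,
        Fin.sum_univ_succ, le_sub_iff_add_le', and_assoc, Fin.insertNthEquiv, Fin.tail]
    rw [← hpre, hmp.measure_preimage hT.nullMeasurableSet]
    change (volume.prod volume) T = _
    rw [Measure.prod_apply hT]
    have hsec : ∀ t : ℝ, volume (Prod.mk t ⁻¹' T) =
        (Set.Icc 0 s).indicator (fun t => ENNReal.ofReal ((s - t) ^ n / n.factorial)) t := by
      intro t
      by_cases ht : t ∈ Set.Icc 0 s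
      · rw [Set.indicator_of_mem ht, ← ih (sub_nonneg.2 ht.2)]
        congr 1
        ext y
        simp [T, ht.1]
      · rw [Set.indicator_of_notMem ht]
        convert measure_empty (μ := (volume : Measure (Fin n → ℝ)))
        ext y
        simp only [T, cornerSimplex, Set.mem_preimage, Set.mem_ofPred_eq, Set.mem_empty_iff_false,
          iff_false, not_and]
        intro h0 h1 h2
        exact ht ⟨h0, by linarith [Finset.sum_nonneg fun i (_ : i ∈ Finset.univ) => h1 i]⟩
    simp_rw [hsec]
    rw [lintegral_indicator measurableSet_Icc, ← ofReal_integral_eq_lintegral_ofReal]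
    · congr 1
      rw [integral_Icc_eq_integral_Ioc, ← intervalIntegral.integral_of_le hs,
        intervalIntegral.integral_div,
        intervalIntegral.integral_comp_sub_left (fun t : ℝ => t ^ n) s]
      simp [integral_pow, Nat.factorial_succ]
      field_simp
    · exact (Continuous.integrableOn_Icc (by fun_prop))
    · rw [Filter.EventuallyLE, ae_restrict_iff' measurableSet_Icc]
      refine Filter.Eventually.of_forall fun t ht => ?_
      have := sub_nonneg.2 ht.2
      simp only [Pi.zero_apply]; positivity

lemma sum_range_alternating_choose_mul (a m : ℕ) :
    ∑ k ∈ Finset.range (m + 1), (-1 : ℝ) ^ (m - k) * (a + k) * (m.choose k) =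
      if m = 0 then (a : ℝ) else if m = 1 then 1 else 0 := by
  rcases m with _ | _ | m
  · simp
  · simp [Finset.sum_range_succ]
  · have h0 := add_pow (1 : ℝ) (-1) (m + 2)
    have h1 := add_pow (1 : ℝ) (-1) (m + 1)
    norm_num at h0 h1
    have h2 : ∑ k ∈ Finset.range (m + 2 + 1), (-1 : ℝ) ^ (m + 2 - k) * k * ((m+2).choose k) = 0 := by
      rw [Finset.sum_range_succ']
      simp only [CharP.cast_eq_zero, mul_zero, zero_mul, add_zero]
      have : ∀ k, ((k + 1 : ℕ) : ℝ) * ((m + 2).choose (k + 1)) = (m + 2) * (m + 1).choose k := by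
        intro k
        have := Nat.add_one_mul_choose_eq (m + 1) k
        rw [mul_comm]
        exact_mod_cast this.symm
      calc _ = ∑ k ∈ Finset.range (m + 2), (m + 2 : ℝ) * ((-1) ^ (m + 1 - k) * (m + 1).choose k) := by
            refine Finset.sum_congr rfl fun k _ => ?_
            rw [mul_assoc, this, show m + 2 - (k + 1) = m + 1 - k by omega]; ring
        _ = 0 := by rw [← Finset.mul_sum, ← h1, mul_zero]
    simp_rw [mul_add, add_mul, Finset.sum_add_distrib, h2]
    simp only [add_zero]
    rw [if_neg (by omega), if_neg (by omega)]
    calc _ = ∑ k ∈ Finset.range (m + 2 + 1), (a : ℝ) * ((-1) ^ (m + 2 - k) * (m + 2).choose k) := by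
            refine Finset.sum_congr rfl fun k _ => ?_
            ring
      _ = 0 := by rw [← Finset.mul_sum, ← h0, mul_zero]

lemma sum_superset_alternating {α : Type*} [Fintype α] [DecidableEq α] (I : Finset α) :
    ∑ J ∈ Finset.univ.filter (I ⊆ ·), (-1 : ℝ) ^ (Fintype.card α - J.card) * J.card =
      if I.card = Fintype.card α then (I.card : ℝ)
        else if I.card + 1 = Fintype.card α then 1 else 0 := by
  have hle := Finset.card_le_univ I
  have h := sum_range_alternating_choose_mul I.card (Fintype.card α - I.card)
  have hif : (if Fintype.card α - I.card = 0 then (I.card : ℝ)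
      else if Fintype.card α - I.card = 1 then 1 else 0) =
      if I.card = Fintype.card α then (I.card : ℝ)
        else if I.card + 1 = Fintype.card α then 1 else 0 := by
    have h1 : Fintype.card α - I.card = 0 ↔ I.card = Fintype.card α := by omega
    have h2 : Fintype.card α - I.card = 1 ↔ I.card + 1 = Fintype.card α := by omega
    simp only [h1, h2]
  rw [← hif, ← h]
  have hset : Finset.univ.filter (I ⊆ ·) = Finset.Icc I Finset.univ := by
    ext J; simp
  rw [hset, Finset.Icc_eq_image_powerset (Finset.subset_univ _), Finset.sum_image]
  · rw [← Finset.compl_eq_univ_sdiff, Finset.sum_powerset, Finset.card_compl]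
    refine Finset.sum_congr rfl fun k hk => ?_
    rw [Finset.sum_congr rfl (g := fun _ => (-1 : ℝ) ^ (Fintype.card α - I.card - k) * (I.card + k))]
    · rw [Finset.sum_const, Finset.card_powersetCard, Finset.card_compl, nsmul_eq_mul]; ring
    · intro J hJ
      rw [Finset.mem_powersetCard] at hJ
      rw [Finset.card_union_of_disjoint (Finset.disjoint_of_subset_right hJ.1
        disjoint_compl_right), hJ.2]
      push_cast
      rw [Nat.sub_add_eq]
  · intro A hA B hB hAB
    simp only [Finset.coe_powerset, Set.mem_preimage, Set.mem_powerset_iff, Finset.coe_subset,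
      ← Finset.compl_eq_univ_sdiff] at hA hB
    ext x
    have := Finset.ext_iff.1 hAB x
    simp only [Finset.mem_union] at this
    by_cases hx : x ∈ I
    · have hA' : x ∉ A := fun h => (Finset.mem_compl.1 (hA h)) hx
      have hB' : x ∉ B := fun h => (Finset.mem_compl.1 (hB h)) hx
      simp [hA', hB']
    · simpa [hx] using this

lemma alternating_sum_faces_eq {n : ℕ} (f s : Finset (Fin (n + 1)) → ℝ)
    (h : ∀ J : Finset (Fin (n + 1)), J.Nonempty → f J = ∑ I ∈ J.powerset, s I) :
    ∑ j ∈ Finset.range (n + 1), (-1 : ℝ) ^ (n - j) * (j + 1) *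
        ∑ J ∈ Finset.univ.filter (fun J : Finset (Fin (n + 1)) => J.card = j + 1), f J =
      (n + 1 : ℝ) * s Finset.univ +
        ∑ I ∈ (Finset.univ : Finset (Fin (n + 1))).powerset.filter (fun I => I.card = n), s I := by
  have h1 : ∑ j ∈ Finset.range (n + 1), (-1 : ℝ) ^ (n - j) * (j + 1) *
        ∑ J ∈ Finset.univ.filter (fun J : Finset (Fin (n + 1)) => J.card = j + 1), f J
      = ∑ j ∈ Finset.range (n + 2), (-1 : ℝ) ^ (n + 1 - j) * j *
        ∑ J ∈ Finset.univ.filter (fun J : Finset (Fin (n + 1)) => J.card = j),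
          ∑ I ∈ J.powerset, s I := by
    rw [Finset.sum_range_succ' _ (n + 1)]
    simp only [CharP.cast_eq_zero, mul_zero, zero_mul, add_zero]
    refine Finset.sum_congr rfl fun j _ => ?_
    rw [Nat.add_sub_add_right]
    push_cast
    congr 1
    refine Finset.sum_congr rfl fun J hJ => h J ?_
    rw [Finset.mem_filter] at hJ
    exact Finset.card_pos.1 (by omega)
  have h2 : ∑ j ∈ Finset.range (n + 2), (-1 : ℝ) ^ (n + 1 - j) * j *
        ∑ J ∈ Finset.univ.filter (fun J : Finset (Fin (n + 1)) => J.card = j),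
          ∑ I ∈ J.powerset, s I
      = ∑ J : Finset (Fin (n + 1)), (-1 : ℝ) ^ (n + 1 - J.card) * J.card *
          ∑ I ∈ J.powerset, s I := by
    rw [← Finset.sum_fiberwise_of_maps_to (s := Finset.univ) (t := Finset.range (n + 2))
      (g := Finset.card)]
    · refine Finset.sum_congr rfl fun j _ => ?_
      rw [Finset.mul_sum]
      refine Finset.sum_congr rfl fun J hJ => ?_
      rw [(Finset.mem_filter.1 hJ).2]
    · intro J _
      have := Finset.card_le_univ J
      simp only [Fintype.card_fin] at this
      simp; omega
  have h3 : ∑ J : Finset (Fin (n + 1)), (-1 : ℝ) ^ (n + 1 - J.card) * J.card *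
          ∑ I ∈ J.powerset, s I
      = ∑ I : Finset (Fin (n + 1)), s I * ∑ J ∈ Finset.univ.filter (I ⊆ ·),
          (-1 : ℝ) ^ (Fintype.card (Fin (n + 1)) - J.card) * J.card := by
    simp_rw [Finset.mul_sum, Fintype.card_fin]
    rw [Finset.sum_comm' (s' := fun I => Finset.univ.filter (I ⊆ ·)) (t' := Finset.univ)]
    · exact Finset.sum_congr rfl fun I _ => Finset.sum_congr rfl fun J _ => by ring
    · simp
  rw [h1, h2, h3]
  simp_rw [sum_superset_alternating, Fintype.card_fin, add_left_inj]
  rw [← Finset.add_sum_erase _ _ (Finset.mem_univ (Finset.univ : Finset (Fin (n + 1))))]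
  congr 1
  · simp; ring
  · rw [Finset.powerset_univ, Finset.sum_filter]
    symm
    rw [← Finset.add_sum_erase _ _ (Finset.mem_univ (Finset.univ : Finset (Fin (n + 1))))]
    rw [if_neg (by simp), zero_add]
    refine Finset.sum_congr rfl fun I hI => ?_
    have : I.card ≠ n + 1 := by
      intro hc
      apply Finset.ne_of_mem_erase hI
      rwa [← Finset.card_eq_iff_eq_univ, Fintype.card_fin]
    simp [this]

/-- The coercion of integer points to real points, as a `ℤ`-linear map. -/
def lattLinearMap (ι : Type*) : (ι → ℤ) →ₗ[ℤ] (ι → ℝ) where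
  toFun := latt
  map_add' x y := by ext; simp [latt]
  map_smul' c x := by ext; simp [latt]

lemma latt_injective {ι : Type*} : Function.Injective (latt : (ι → ℤ) → ι → ℝ) := by
  intro x y h
  ext i
  have := congrFun h i
  simpa [latt] using this

lemma latt_sum_smul {ι κ : Type*} [Fintype κ] (c : κ → ℤ) (w : κ → ι → ℤ) :
    latt (∑ k, c k • w k) = ∑ k, (c k : ℝ) • latt (w k) := by
  ext i; simp [latt]

lemma latt_sub {ι : Type*} (x y : ι → ℤ) : latt (x - y) = latt x - latt y := by
  ext i; simp [latt]

lemma latt_add {ι : Type*} (x y : ι → ℤ) : latt (x + y) = latt x + latt y := by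
  ext i; simp [latt]

lemma latt_zsmul {ι : Type*} (c : ℤ) (y : ι → ℤ) : latt (c • y) = (c : ℝ) • latt y := by
  ext i; simp [latt]

/-- The coefficient vectors in `[0, 1)` of the integer points of a half-open parallelepiped. -/
def fundCoeffs {ι κ : Type*} [Fintype κ] (w : κ → ι → ℝ) : Set (κ → ℝ) :=
  {c | (∀ k, 0 ≤ c k ∧ c k < 1) ∧ ∃ y : ι → ℤ, latt y = ∑ k, c k • w k}

lemma ncard_fundCoeffs_eq_natAbs_det {j : ℕ} (w : Fin j → Fin j → ℤ)
    (hw : LinearIndependent ℝ fun k => latt (w k)) :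
    (fundCoeffs fun k => latt (w k)).ncard = (Matrix.det (Matrix.of w)).natAbs := by
  have hwZ : LinearIndependent ℤ w := by
    have h : LinearIndependent ℤ (lattLinearMap (Fin j) ∘ w) :=
      hw.restrict_scalars (R := ℤ) (by
        intro a b hab
        simpa using hab)
    exact h.of_comp
  let N : Submodule ℤ (Fin j → ℤ) := Submodule.span ℤ (Set.range w)
  have hidx := AddSubgroup.index_eq_natAbs_det (Pi.basisFun ℤ (Fin j)) N.toAddSubgroup
    (Module.Basis.span hwZ)
  have hdet : (Pi.basisFun ℤ (Fin j)).det
      (fun k => ((Module.Basis.span hwZ k : N) : Fin j → ℤ)) = Matrix.det (Matrix.of w) := by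
    rw [Module.Basis.det_apply, ← Matrix.det_transpose]
    congr 1
    ext a b
    simp [Module.Basis.toMatrix_apply, Module.Basis.span_apply]
  rw [← hdet]
  refine Eq.trans ?_ hidx
  let b : Module.Basis (Fin j) ℝ (Fin j → ℝ) :=
    Module.Basis.mk hw (hw.span_eq_top_of_card_eq_finrank' (by simp)).ge
  have hb : ∀ k, b k = latt (w k) := fun k => by simp [b]
  have hrepr : ∀ x, ∑ k, b.repr x k • latt (w k) = x := fun x => by
    simpa [hb] using b.sum_repr x
  let g : (Fin j → ℤ) → fundCoeffs (fun k => latt (w k)) := fun y =>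
    ⟨fun k => Int.fract (b.repr (latt y) k), fun k => ⟨Int.fract_nonneg _, Int.fract_lt_one _⟩,
      y - ∑ k, ⌊b.repr (latt y) k⌋ • w k, by
        rw [latt_sub, latt_sum_smul]
        simp_rw [Int.fract, sub_smul, Finset.sum_sub_distrib, hrepr]⟩
  have hsurj : Function.Surjective g := by
    rintro ⟨c, hc, y, hy⟩
    refine ⟨y, Subtype.ext (funext fun k => ?_)⟩
    have : b.repr (latt y) k = c k := by
      rw [hy]
      simp_rw [← hb]
      rw [b.repr_sum_self]
    simp only [g, this]
    exact Int.fract_eq_self.2 (hc k)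
  have hfib : ∀ x y, g x = g y ↔ -x + y ∈ N := by
    intro x y
    rw [Submodule.mem_span_range_iff_exists_fun]
    constructor
    · intro h
      have h' : ∀ k, ∃ z : ℤ, b.repr (latt y) k - b.repr (latt x) k = z := fun k =>
        Int.fract_eq_fract.1 (congrFun (congrArg Subtype.val h) k).symm
      choose z hz using h'
      refine ⟨z, latt_injective ?_⟩
      rw [latt_sum_smul]
      simp_rw [← hz, sub_smul, Finset.sum_sub_distrib, hrepr]
      rw [← latt_sub]; congr 1; abel
    · rintro ⟨z, hz⟩
      have hy : y = x + ∑ k, z k • w k := by rw [hz]; abel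
      refine Subtype.ext (funext fun k => ?_)
      simp only [g]
      rw [hy, latt_add, latt_sum_smul]
      simp_rw [← hb]
      rw [map_add, Finsupp.add_apply, b.repr_sum_self]
      simp
  rw [AddSubgroup.index, ← Nat.card_coe_set_eq]
  symm
  refine Nat.card_eq_of_bijective (Quotient.lift g fun x y hxy => ?_) ⟨?_, ?_⟩
  · exact (hfib x y).2 (QuotientAddGroup.leftRel_apply.1 hxy)
  · rintro ⟨x⟩ ⟨y⟩ h
    exact Quotient.sound (QuotientAddGroup.leftRel_apply.2 ((hfib x y).1 h))
  · exact fun c => (hsurj c).elim fun y hy => ⟨⟦y⟧, hy⟩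

lemma exists_lattice_param {n j : ℕ} (u : Fin j → Fin n → ℤ)
    (hu : LinearIndependent ℝ fun k => latt (u k)) :
    ∃ f : (Fin j → ℝ) →ₗ[ℝ] (Fin n → ℝ), Function.Injective f ∧
      LinearMap.range f = Submodule.span ℝ (Set.range fun k => latt (u k)) ∧
      ∀ x : Fin j → ℝ, (∃ w : Fin j → ℤ, x = latt w) ↔ ∃ z : Fin n → ℤ, f x = latt z := by
  set V := Submodule.span ℝ (Set.range fun k => latt (u k)) with hV
  let L₀ : Submodule ℤ (Fin n → ℝ) := Submodule.span ℤ (Set.range (Pi.basisFun ℝ (Fin n)))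
  have hL₀ : ∀ x, x ∈ L₀ ↔ ∃ z : Fin n → ℤ, x = latt z := by
    intro x
    rw [Submodule.mem_span_range_iff_exists_fun]
    refine exists_congr fun z => ?_
    have : ∑ i, z i • (Pi.basisFun ℝ (Fin n)) i = latt z := by
      ext i; simp [latt, Finset.sum_apply, Pi.single_apply]
    rw [this, eq_comm]
  let L : Submodule ℤ V := ZLattice.comap ℝ L₀ V.subtype
  have hL : ∀ x : V, x ∈ L ↔ ∃ z : Fin n → ℤ, (x : Fin n → ℝ) = latt z := fun x => hL₀ x
  have : DiscreteTopology L := ZLattice.comap_discreteTopology ℝ L₀ continuous_subtype_val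
    Subtype.val_injective
  let b₀ : Module.Basis (Fin j) ℝ V := Module.Basis.span hu
  have hb₀ : ∀ k, ((b₀ k : V) : Fin n → ℝ) = latt (u k) :=
    fun k => congrArg Subtype.val (Module.Basis.span_apply hu k)
  have : IsZLattice ℝ L := ⟨by
    rw [eq_top_iff, ← b₀.span_eq]
    refine Submodule.span_mono ?_
    rintro _ ⟨k, rfl⟩
    exact (hL _).2 ⟨u k, hb₀ k⟩⟩
  have : Module.Free ℤ L := ZLattice.module_free ℝ L
  have : Module.Finite ℤ L := ZLattice.module_finite ℝ L
  have hrank : Module.finrank ℤ L = j := by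
    rw [ZLattice.rank ℝ L, Module.finrank_eq_card_basis b₀, Fintype.card_fin]
  let b : Module.Basis (Fin j) ℤ L := Module.finBasisOfFinrankEq ℤ L hrank
  let B := b.ofZLatticeBasis ℝ L
  refine ⟨V.subtype ∘ₗ B.equivFun.symm.toLinearMap, ?_, ?_, fun x => ?_⟩
  · exact Subtype.val_injective.comp B.equivFun.symm.injective
  · rw [LinearMap.range_comp, LinearEquiv.range]; simp
  · have h1 : (∃ z : Fin n → ℤ, (V.subtype ∘ₗ B.equivFun.symm.toLinearMap) x = latt z) ↔
        B.equivFun.symm x ∈ L := (hL _).symm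
    rw [h1, ← b.ofZLatticeBasis_span ℝ L, Submodule.mem_span_range_iff_exists_fun]
    refine exists_congr fun w => ?_
    have : ∑ k, w k • B k = B.equivFun.symm (latt w) := by
      simp [Module.Basis.equivFun_symm_apply, latt, Int.cast_smul_eq_zsmul]
    change _ ↔ ∑ k, w k • B k = _
    rw [this, B.equivFun.symm.injective.eq_iff, eq_comm]

lemma volume_linearCombination_cornerSimplex {j : ℕ} (w : Fin j → Fin j → ℤ) :
    (j.factorial : ℝ) * (volume ((fun c : Fin j → ℝ => ∑ k, c k • latt (w k)) ''
      cornerSimplex j 1)).toReal = ((Matrix.det (Matrix.of w)).natAbs : ℝ) := by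
  let A : (Fin j → ℝ) →ₗ[ℝ] (Fin j → ℝ) :=
    Matrix.toLin' ((Matrix.of w).map (Int.castRingHom ℝ)).transpose
  have hA : (fun c : Fin j → ℝ => ∑ k, c k • latt (w k)) = A := by
    ext c i
    simp [A, Matrix.mulVec, dotProduct, latt, mul_comm]
  have hdet : LinearMap.det A = ((Matrix.det (Matrix.of w) : ℤ) : ℝ) := by
    simp only [A, LinearMap.det_toLin', Matrix.det_transpose]
    exact ((Int.castRingHom ℝ).map_det _).symm
  rw [hA, Measure.addHaar_image_linearMap, volume_cornerSimplex j zero_le_one, hdet,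
    ENNReal.toReal_mul, ENNReal.toReal_ofReal (abs_nonneg _),
    ENNReal.toReal_ofReal (by positivity), Nat.cast_natAbs, Int.cast_abs]
  field_simp
  simp

/-- The coefficient vectors in `[0, 1)` of the integer points of the half-open parallelepiped
spanned by the vectors `(u i, 1)`. -/
def coneCoeffs {ι κ : Type*} [Fintype κ] (u : κ → ι → ℤ) : Set (κ → ℝ) :=
  {c | (∀ k, 0 ≤ c k ∧ c k < 1) ∧
    (∃ y : ι → ℤ, latt y = ∑ k, c k • latt (u k)) ∧ ∃ m : ℤ, (m : ℝ) = ∑ k, c k}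

lemma linearIndependent_latt_sub {n j : ℕ} (u : Fin (j + 1) → Fin n → ℤ)
    (hu : AffineIndependent ℝ fun i => latt (u i)) :
    LinearIndependent ℝ fun k : Fin j => latt (u k.succ - u 0) := by
  have h := (affineIndependent_iff_linearIndependent_vsub ℝ _ (0 : Fin (j + 1))).1 hu
  have h2 := h.comp (fun k : Fin j => ⟨k.succ, Fin.succ_ne_zero k⟩) (by
    intro a b hab
    simpa using hab)
  simpa [Function.comp_def, latt_sub] using h2

lemma ncard_coneCoeffs {n j : ℕ} (u : Fin (j + 1) → Fin n → ℤ)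
    (f : (Fin j → ℝ) →ₗ[ℝ] (Fin n → ℝ))
    (hf : ∀ x : Fin j → ℝ, (∃ w : Fin j → ℤ, x = latt w) ↔ ∃ z : Fin n → ℤ, f x = latt z)
    (w : Fin j → Fin j → ℤ) (hw : ∀ k, f (latt (w k)) = latt (u k.succ - u 0)) :
    (coneCoeffs u).ncard = (fundCoeffs fun k => latt (w k)).ncard := by
  have hfs : ∀ c : Fin j → ℝ, f (∑ k, c k • latt (w k)) =
      ∑ k, c k • latt (u k.succ) - (∑ k, c k) • latt (u 0) := by
    intro c
    simp [hw, latt_sub, smul_sub, Finset.sum_sub_distrib, Finset.sum_smul]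
  refine Set.ncard_congr (fun c _ => Fin.tail c) ?_ ?_ ?_
  · rintro c ⟨hc, ⟨y, hy⟩, m, hm⟩
    refine ⟨fun k => hc k.succ, ?_⟩
    obtain ⟨z, hz⟩ := (hf (∑ k, Fin.tail c k • latt (w k))).2 ⟨y - m • u 0, by
      rw [hfs, latt_sub, latt_zsmul, hy, hm, Fin.sum_univ_succ, Fin.sum_univ_succ, add_smul]
      simp only [Fin.tail]; abel⟩
    exact ⟨z, hz.symm⟩
  · rintro c d ⟨hc, -, m, hm⟩ ⟨hd, -, m', hm'⟩ h
    have h0 : c 0 = d 0 := by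
      rw [← Int.fract_eq_self.2 (hc 0), ← Int.fract_eq_self.2 (hd 0), Int.fract_eq_fract]
      refine ⟨m - m', ?_⟩
      push_cast
      rw [hm, hm', Fin.sum_univ_succ, Fin.sum_univ_succ]
      have : ∀ k : Fin j, c k.succ = d k.succ := congrFun h
      simp [this]
    rw [← Fin.cons_self_tail c, ← Fin.cons_self_tail d, h0, h]
  · rintro c ⟨hc, y, hy⟩
    obtain ⟨z, hz⟩ := (hf _).1 ⟨y, hy.symm⟩
    rw [hfs] at hz
    refine ⟨Fin.cons (Int.fract (-∑ k, c k)) c, ⟨?_, ⟨z - ⌊-∑ k, c k⌋ • u 0, ?_⟩,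
      -⌊-∑ k, c k⌋, ?_⟩, Fin.tail_cons _ _⟩
    · refine Fin.cases ?_ hc
      exact ⟨Int.fract_nonneg _, Int.fract_lt_one _⟩
    · rw [latt_sub, latt_zsmul, ← hz, Fin.sum_univ_succ]
      simp only [Fin.cons_zero, Fin.cons_succ, Int.fract, sub_smul, neg_smul]
      abel
    · rw [Fin.sum_univ_succ]
      simp only [Fin.cons_zero, Fin.cons_succ, Int.fract, Int.cast_neg]
      ring

lemma mem_convexHull_range_iff {ι E : Type*} [Fintype ι] [AddCommGroup E] [Module ℝ E]
    (p : ι → E) (x : E) :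
    x ∈ convexHull ℝ (Set.range p) ↔
      ∃ c : ι → ℝ, (∀ i, 0 ≤ c i) ∧ ∑ i, c i = 1 ∧ ∑ i, c i • p i = x := by
  constructor
  · rw [mem_convexHull_iff_exists_fintype]
    rintro ⟨κ, _, w, z, hw, hw1, hz, rfl⟩
    classical
    choose g hg using hz
    refine ⟨fun i => ∑ k ∈ Finset.univ.filter (fun k => g k = i), w k,
      fun i => Finset.sum_nonneg fun k _ => hw k, ?_, ?_⟩
    · exact (Finset.sum_fiberwise _ _ _).trans hw1
    · rw [← Finset.sum_fiberwise (s := Finset.univ) (g := g)]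
      refine Finset.sum_congr rfl fun i _ => ?_
      rw [Finset.sum_smul]
      refine Finset.sum_congr rfl fun k hk => ?_
      rw [← hg, (Finset.mem_filter.1 hk).2]
  · rintro ⟨c, h0, h1, h⟩
    exact mem_convexHull_of_exists_fintype c p h0 h1 (fun i => ⟨i, rfl⟩) h

lemma exists_unimodularParam {n j : ℕ} (u : Fin (j + 1) → Fin n → ℤ)
    (hu : AffineIndependent ℝ fun i => latt (u i)) :
    ∃ φ : (Fin j → ℝ) →ᵃ[ℝ] (Fin n → ℝ),
      IsUnimodularParam (convexHull ℝ (Set.range fun i => latt (u i))) φ ∧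
      (j.factorial : ℝ) *
        (volume (φ ⁻¹' convexHull ℝ (Set.range fun i => latt (u i)))).toReal =
          (coneCoeffs u).ncard ∧ (coneCoeffs u).Finite := by
  have hli := linearIndependent_latt_sub u hu
  obtain ⟨f, hinj, hrange, hf⟩ := exists_lattice_param _ hli
  have hex : ∀ k : Fin j, ∃ w : Fin j → ℤ, f (latt w) = latt (u k.succ - u 0) := by
    intro k
    have hmem : latt (u k.succ - u 0) ∈ LinearMap.range f := by
      rw [hrange]; exact Submodule.subset_span ⟨k, rfl⟩
    obtain ⟨x, hx⟩ := hmem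
    obtain ⟨w, rfl⟩ := (hf x).2 ⟨_, hx⟩
    exact ⟨w, hx⟩
  choose w hw using hex
  have hwli : LinearIndependent ℝ fun k => latt (w k) := by
    refine LinearIndependent.of_comp f ?_
    simpa [Function.comp_def, hw] using hli
  have hcount := ncard_coneCoeffs u f hf w hw
  have hdet := ncard_fundCoeffs_eq_natAbs_det w hwli
  have hdet0 : (Matrix.det (Matrix.of w)).natAbs ≠ 0 := by
    have h1 : LinearIndependent ℝ ((Matrix.of w).map (Int.castRingHom ℝ)).row := hwli
    rw [Matrix.linearIndependent_rows_iff_isUnit, Matrix.isUnit_iff_isUnit_det,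
      ← RingHom.mapMatrix_apply, ← RingHom.map_det, isUnit_iff_ne_zero] at h1
    intro h
    exact h1 (by rw [Int.natAbs_eq_zero.1 h]; simp)
  let φ : (Fin j → ℝ) →ᵃ[ℝ] (Fin n → ℝ) :=
    f.toAffineMap + AffineMap.const ℝ (Fin j → ℝ) (latt (u 0))
  have hφ : ∀ x, φ x = f x + latt (u 0) := fun x => rfl
  have hφinj : Function.Injective φ := fun x y h => hinj (by simpa [hφ] using h)
  have hφpre : φ ⁻¹' convexHull ℝ (Set.range fun i => latt (u i)) =
      (fun c : Fin j → ℝ => ∑ k, c k • latt (w k)) '' cornerSimplex j 1 := by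
    have hval : ∀ c : Fin (j + 1) → ℝ, ∑ i, c i = 1 →
        ∑ i, c i • latt (u i) = φ (∑ k, c (Fin.succ k) • latt (w k)) := by
      intro c hc
      rw [Fin.sum_univ_succ] at hc ⊢
      rw [hφ, map_sum]
      simp_rw [map_smul, hw, latt_sub, smul_sub, Finset.sum_sub_distrib, ← Finset.sum_smul]
      rw [← eq_sub_iff_add_eq] at hc
      rw [hc, sub_smul, one_smul]
      abel
    ext x
    rw [Set.mem_preimage, mem_convexHull_range_iff]
    constructor
    · rintro ⟨c, h0, h1, h⟩
      refine ⟨Fin.tail c, ⟨fun k => h0 _, ?_⟩, hφinj ?_⟩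
      · rw [Fin.sum_univ_succ] at h1
        simp only [Fin.tail]
        linarith [h0 0]
      · rw [← h, hval c h1]; rfl
    · rintro ⟨c, ⟨h0, h1⟩, rfl⟩
      have hs : ∑ i, (Fin.cons (1 - ∑ k, c k) c : Fin (j + 1) → ℝ) i = 1 := by
        simp [Fin.sum_univ_succ]
      refine ⟨Fin.cons (1 - ∑ k, c k) c, ?_, hs, ?_⟩
      · exact Fin.cases (by simpa using h1) (by simpa using h0)
      · rw [hval _ hs]; simp
  refine ⟨φ, ⟨hφinj, ?_, fun x => ?_⟩, ?_, ?_⟩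
  · rw [affineSpan_convexHull]
    ext y
    have h0 : latt (u 0) ∈ affineSpan ℝ (Set.range fun i => latt (u i)) :=
      subset_affineSpan _ _ ⟨0, rfl⟩
    rw [SetLike.mem_coe, ← AffineSubspace.vsub_right_mem_direction_iff_mem h0,
      direction_affineSpan, vectorSpan_range_eq_span_range_vsub_right ℝ _ (0 : Fin (j + 1))]
    have hspan : Submodule.span ℝ (Set.range fun i : Fin (j + 1) => latt (u i) -ᵥ latt (u 0)) =
        LinearMap.range f := by
      rw [hrange]
      refine le_antisymm (Submodule.span_le.2 ?_) (Submodule.span_mono ?_)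
      · rintro _ ⟨i, rfl⟩
        refine Fin.cases ?_ (fun k => ?_) i
        · simp
        · exact Submodule.subset_span ⟨k, latt_sub _ _⟩
      · rintro _ ⟨k, rfl⟩
        exact ⟨k.succ, (latt_sub _ _).symm⟩
    rw [hspan]
    simp only [Set.mem_range, hφ, LinearMap.mem_range, vsub_eq_sub, eq_sub_iff_add_eq]
  · rw [hf x]
    constructor
    · rintro ⟨z, hz⟩
      exact ⟨z + u 0, by rw [hφ, hz, latt_add]⟩
    · rintro ⟨z, hz⟩
      exact ⟨z - u 0, by rw [latt_sub, ← hz, hφ]; abel⟩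
  · rw [hφpre, volume_linearCombination_cornerSimplex, hcount, hdet]
  · refine Set.finite_of_ncard_ne_zero ?_
    rw [hcount, hdet]
    exact hdet0

lemma vhat_castSucc {n : ℕ} (v : Fin (n + 1) → Fin n → ℤ) (i : Fin (n + 1)) (a : Fin n) :
    vhat v i a.castSucc = latt (v i) a := by
  simp [vhat]

lemma vhat_last {n : ℕ} (v : Fin (n + 1) → Fin n → ℤ) (i : Fin (n + 1)) :
    vhat v i (Fin.last n) = 1 := by
  simp [vhat]

lemma linearIndependent_vhat {n : ℕ} (v : Fin (n + 1) → Fin n → ℤ)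
    (hind : AffineIndependent ℝ (fun i => latt (v i))) : LinearIndependent ℝ (vhat v) := by
  rw [Fintype.linearIndependent_iff]
  intro c hc i
  refine (affineIndependent_iff.1 hind) Finset.univ c ?_ ?_ i (Finset.mem_univ i)
  · have := congrFun hc (Fin.last n)
    simpa [Finset.sum_apply, vhat_last] using this
  · ext a
    have := congrFun hc a.castSucc
    simpa [Finset.sum_apply, vhat_castSucc] using this

lemma exists_latt_eq_sum_vhat_iff {n : ℕ} {κ : Type*} [Fintype κ]
    (v : Fin (n + 1) → Fin n → ℤ) (e : κ → Fin (n + 1)) (c : κ → ℝ) :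
    (∃ x : Fin (n + 1) → ℤ, latt x = ∑ k, c k • vhat v (e k)) ↔
      (∃ y : Fin n → ℤ, latt y = ∑ k, c k • latt (v (e k))) ∧ ∃ m : ℤ, (m : ℝ) = ∑ k, c k := by
  constructor
  · rintro ⟨x, hx⟩
    refine ⟨⟨fun a => x a.castSucc, ?_⟩, x (Fin.last n), ?_⟩
    · ext a
      have := congrFun hx a.castSucc
      simpa [latt, Finset.sum_apply, vhat_castSucc] using this
    · have := congrFun hx (Fin.last n)
      simpa [latt, Finset.sum_apply, vhat_last] using this
  · rintro ⟨⟨y, hy⟩, m, hm⟩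
    refine ⟨Fin.snoc y m, funext fun a => Fin.lastCases ?_ (fun a => ?_) a⟩
    · simp [latt, Finset.sum_apply, vhat_last, hm]
    · have := congrFun hy a
      simpa [latt, Finset.sum_apply, vhat_castSucc] using this

lemma sI_map_eq_ncard {n : ℕ} {κ : Type*} [Fintype κ] (v : Fin (n + 1) → Fin n → ℤ)
    (hind : AffineIndependent ℝ (fun i => latt (v i))) (e : κ ↪ Fin (n + 1)) (K : Finset κ) :
    sI v (K.map e) =
      {c ∈ coneCoeffs fun k => v (e k) | ∀ k, c k ≠ 0 ↔ k ∈ K}.ncard := by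
  classical
  let g : (κ → ℝ) → Fin (n + 1) → ℝ := fun c => ∑ k, c k • vhat v (e k)
  have hg : Function.Injective g :=
    fun c d h => funext (Fintype.linearIndependent_iffₛ.1
      ((linearIndependent_vhat v hind).comp e e.injective) c d h)
  rw [sI, ← Set.ncard_image_of_injective _ latt_injective, ← Set.ncard_image_of_injective _ hg]
  congr 1
  ext z
  constructor
  · rintro ⟨x, ⟨lam, hlam, hx⟩, rfl⟩
    have hsum : latt x = g (fun k => if k ∈ K then lam (e k) else 0) := by
      simp [g, hx, ite_smul, Finset.sum_ite_mem]
    refine ⟨fun k => if k ∈ K then lam (e k) else 0, ⟨⟨fun k => ?_, ?_⟩, fun k => ?_⟩, hsum.symm⟩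
    · by_cases hk : k ∈ K
      · have := hlam (e k) (Finset.mem_map_of_mem e hk)
        simp [hk, this.1.le, this.2]
      · simp [hk]
    · exact (exists_latt_eq_sum_vhat_iff v e _).1 ⟨x, hsum⟩
    · by_cases hk : k ∈ K
      · have := hlam (e k) (Finset.mem_map_of_mem e hk)
        simp [hk, this.1.ne']
      · simp [hk]
  · rintro ⟨c, ⟨⟨hc, hint⟩, hK⟩, rfl⟩
    obtain ⟨x, hx⟩ := (exists_latt_eq_sum_vhat_iff v e c).2 hint
    refine ⟨x, ⟨Function.extend e c 0, ?_, ?_⟩, hx⟩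
    · intro i hi
      obtain ⟨k, hk, rfl⟩ := Finset.mem_map.1 hi
      rw [e.injective.extend_apply]
      exact ⟨(hc k).1.lt_of_ne' ((hK k).2 hk), (hc k).2⟩
    · rw [hx, Finset.sum_map]
      simp only [e.injective.extend_apply]
      symm
      refine Finset.sum_subset (Finset.subset_univ K) fun k _ hk => ?_
      rw [not_not.1 (mt (hK k).1 hk), zero_smul]

lemma sum_sI_powerset_map {n : ℕ} {κ : Type*} [Fintype κ] (v : Fin (n + 1) → Fin n → ℤ)
    (hind : AffineIndependent ℝ (fun i => latt (v i))) (e : κ ↪ Fin (n + 1))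
    (hfin : (coneCoeffs fun k => v (e k)).Finite) :
    ∑ I ∈ (Finset.univ.map e).powerset, sI v I = (coneCoeffs fun k => v (e k)).ncard := by
  classical
  have hpow : (Finset.univ.map e).powerset =
      (Finset.univ : Finset (Finset κ)).map (Finset.mapEmbedding e).toEmbedding := by
    ext I
    simp [Finset.subset_map_iff, eq_comm]
  rw [hpow, Finset.sum_map, Set.ncard_eq_toFinset_card _ hfin,
    Finset.card_eq_sum_card_fiberwise (t := Finset.univ)
      (f := fun c : κ → ℝ => Finset.univ.filter fun k => c k ≠ 0) (fun _ _ => Finset.mem_univ _)]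
  refine Finset.sum_congr rfl fun K _ => ?_
  change sI v (K.map e) = _
  rw [sI_map_eq_ncard v hind, ← Set.ncard_coe_finset]
  congr 1
  ext c
  simp [Finset.ext_iff]

lemma mem_convexHull_image_iff {ι E : Type*} [Fintype ι] [AddCommGroup E] [Module ℝ E]
    (b : AffineBasis ι ℝ E) (J : Finset ι) (x : E) :
    x ∈ convexHull ℝ (b '' J) ↔ (∀ i, 0 ≤ b.coord i x) ∧ ∀ i ∉ J, b.coord i x = 0 := by
  classical
  constructor
  · have hconv : Convex ℝ ((⋂ i, b.coord i ⁻¹' Set.Ici 0) ∩ ⋂ i ∉ J, b.coord i ⁻¹' {0}) :=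
      (convex_iInter fun i => (convex_Ici 0).affine_preimage _).inter
        (convex_iInter₂ fun i _ => (convex_singleton 0).affine_preimage _)
    have hsub := convexHull_min (s := b '' J) (t := _) (by
      rintro _ ⟨k, hk, rfl⟩
      simp only [Set.mem_inter_iff, Set.mem_iInter, Set.mem_preimage, Set.mem_Ici,
        Set.mem_singleton_iff, b.coord_apply]
      refine ⟨fun i => by split_ifs <;> simp, fun i hi => if_neg ?_⟩
      rintro rfl
      exact hi hk) hconv
    intro hx
    simpa using hsub hx
  · rintro ⟨h0, hJ⟩
    rw [← b.linear_combination_coord_eq_self x,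
      ← Finset.sum_subset (Finset.subset_univ J) (fun i _ hi => by rw [hJ i hi, zero_smul])]
    refine (convex_convexHull ℝ _).sum_mem (fun i _ => h0 i) ?_
      fun i hi => subset_convexHull ℝ _ ⟨i, hi, rfl⟩
    rw [← b.sum_coord_apply_eq_one x]
    exact Finset.sum_subset (Finset.subset_univ J) fun i _ hi => hJ i hi

lemma convexHull_image_injective {ι E : Type*} [Fintype ι] [AddCommGroup E] [Module ℝ E]
    (b : AffineBasis ι ℝ E) :
    Function.Injective fun J : Finset ι => convexHull ℝ (b '' (J : Set ι)) := by
  classical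
  have hmem : ∀ (J : Finset ι) i, b i ∈ convexHull ℝ (b '' (J : Set ι)) ↔ i ∈ J := by
    intro J i
    constructor
    · intro h
      by_contra hi
      have := ((mem_convexHull_image_iff b J _).1 h).2 i hi
      simp at this
    · exact fun h => subset_convexHull ℝ _ ⟨i, h, rfl⟩
  intro J J' h
  ext i
  rw [← hmem J, ← hmem J']
  exact iff_of_eq (congrArg (b i ∈ ·) h)

lemma setOf_max_eq_convexHull_image {ι E : Type*} [Fintype ι] [AddCommGroup E] [Module ℝ E]
    (b : AffineBasis ι ℝ E) (l : E →ₗ[ℝ] ℝ) (M : ℝ) (hM : ∀ i, l (b i) ≤ M)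
    (J : Finset ι) (hJ : ∀ i, i ∈ J ↔ l (b i) = M) (hne : J.Nonempty) :
    {x ∈ convexHull ℝ (Set.range b) | ∀ y ∈ convexHull ℝ (Set.range b), l y ≤ l x} =
      convexHull ℝ (b '' J) := by
  have hl : ∀ x, M - l x = ∑ i, b.coord i x * (M - l (b i)) := by
    intro x
    simp_rw [mul_sub, Finset.sum_sub_distrib, ← Finset.sum_mul, b.sum_coord_apply_eq_one, one_mul]
    congr 1
    have h := congrArg l (b.linear_combination_coord_eq_self x)
    rw [map_sum] at h
    simp only [map_smul, smul_eq_mul] at h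
    exact h.symm
  obtain ⟨i₀, hi₀⟩ := hne
  ext x
  rw [mem_convexHull_image_iff, Set.mem_sep_iff, b.convexHull_eq_nonneg_coord]
  refine and_congr_right fun hx => ?_
  have hx0 : ∀ i, 0 ≤ b.coord i x := hx
  have hterm : ∀ y, (∀ i, 0 ≤ b.coord i y) → ∀ i ∈ Finset.univ,
      0 ≤ b.coord i y * (M - l (b i)) :=
    fun y hy i _ => mul_nonneg (hy i) (sub_nonneg.2 (hM i))
  constructor
  · intro h i hi
    have h1 : M ≤ l x := by
      rw [← (hJ i₀).1 hi₀]
      refine h (b i₀) ?_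
      rw [← b.convexHull_eq_nonneg_coord]
      exact subset_convexHull ℝ _ ⟨i₀, rfl⟩
    have h2 : ∑ i, b.coord i x * (M - l (b i)) = 0 :=
      le_antisymm (by rw [← hl]; linarith) (Finset.sum_nonneg (hterm x hx0))
    have h3 := (Finset.sum_eq_zero_iff_of_nonneg (hterm x hx0)).1 h2 i (Finset.mem_univ i)
    refine (mul_eq_zero.1 h3).resolve_right fun h4 => hi ((hJ i).2 ?_)
    linarith
  · intro h y hy
    have h1 : M - l x = 0 := by
      rw [hl]
      refine Finset.sum_eq_zero fun i _ => ?_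
      by_cases hi : i ∈ J
      · rw [(hJ i).1 hi, sub_self, mul_zero]
      · rw [h i hi, zero_mul]
    have h2 : 0 ≤ M - l y := by
      rw [hl]; exact Finset.sum_nonneg (hterm y hy)
    linarith

lemma isFaceOfDim_convexHull_range_iff {n : ℕ} (b : AffineBasis (Fin (n + 1)) ℝ (Fin n → ℝ))
    (F : Set (Fin n → ℝ)) (j : ℕ) :
    IsFaceOfDim (convexHull ℝ (Set.range b)) F j ↔
      ∃ J : Finset (Fin (n + 1)), J.card = j + 1 ∧ convexHull ℝ (b '' J) = F := by
  classical
  have hdim : ∀ (J : Finset (Fin (n + 1))) (k : ℕ), J.card = k + 1 →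
      Module.finrank ℝ (affineSpan ℝ (convexHull ℝ (b '' (J : Set (Fin (n + 1)))))).direction
        = k := by
    intro J k hk
    rw [affineSpan_convexHull, direction_affineSpan, ← Finset.coe_image]
    exact b.ind.finrank_vectorSpan_image_finset hk
  constructor
  · rintro ⟨hne, hexp, hrank⟩
    obtain ⟨l, hl⟩ := hexp hne
    obtain ⟨i₀, hi₀⟩ := Finite.exists_max fun i => l (b i)
    let J := Finset.univ.filter fun i => l (b i) = l (b i₀)
    have hJne : J.Nonempty := ⟨i₀, by simp [J]⟩
    have hF : convexHull ℝ (b '' J) = F := by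
      rw [hl]
      exact (setOf_max_eq_convexHull_image b l.toLinearMap (l (b i₀)) hi₀ J (by simp [J])
        hJne).symm
    refine ⟨J, ?_, hF⟩
    have hc := Finset.card_pos.2 hJne
    have := hdim J (J.card - 1) (by omega)
    rw [hF, hrank] at this
    omega
  · rintro ⟨J, hJ, rfl⟩
    have hJne : J.Nonempty := Finset.card_pos.1 (by omega)
    refine ⟨(hJne.to_set.image b).convexHull, fun _ => ?_, hdim J j hJ⟩
    let l : (Fin n → ℝ) →ₗ[ℝ] ℝ := ∑ k ∈ J, (b.coord k).linear
    let a : ℝ := ∑ k ∈ J, b.coord k 0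
    have hl : ∀ i, l (b i) = (if i ∈ J then 1 else 0) - a := by
      intro i
      have h : ∀ k, (b.coord k).linear (b i) = b.coord k (b i) - b.coord k 0 := fun k => by
        rw [AffineMap.decomp' (b.coord k)]; simp
      simp only [l, a, LinearMap.sum_apply, h, Finset.sum_sub_distrib, b.coord_apply,
        Finset.sum_ite_eq']
    refine ⟨LinearMap.toContinuousLinearMap l, ?_⟩
    symm
    refine setOf_max_eq_convexHull_image b l (1 - a) (fun i => ?_) J (fun i => ?_) hJne
    · rw [hl]; split_ifs <;> simp
    · rw [hl]
      split_ifs with h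
      · simp [h]
      · simp only [h, false_iff]
        intro h'
        linarith

/-- For an `n`-dimensional lattice simplex `P ⊂ ℝ^n` with vertices
`v_0, …, v_n`, the invariant `c(P) = ∑_{j=0}^n (-1)^{n-j} (j+1) ∑_{F ∈ F(P)_j} Vol_ℤ(F)`
satisfies `c(P) = (n+1)·s_{{0,…,n}} + ∑_{|I| = n} s_I`; in particular `c(P) = 0` if and
only if `s_I = 0` for every `I` with `|I| ≥ n`. -/
theorem simplex_c_top_formula {n : ℕ} (v : Fin (n + 1) → Fin n → ℤ)
    (hind : AffineIndependent ℝ (fun i => latt (v i)))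
    (P : Set (Fin n → ℝ)) (hP : P = convexHull ℝ (Set.range (fun i => latt (v i))))
    (hfull : affineSpan ℝ P = ⊤)
    (VolZ : ℕ → Set (Fin n → ℝ) → ℝ)
    (hVolZ : ∀ (j : ℕ) (F : Set (Fin n → ℝ)), IsFaceOfDim P F j →
      ∀ φ : (Fin j → ℝ) →ᵃ[ℝ] (Fin n → ℝ), IsUnimodularParam F φ →
        VolZ j F = (Nat.factorial j : ℝ) * (volume (φ ⁻¹' F)).toReal) :
    (∑ j ∈ Finset.range (n + 1),
        (-1 : ℝ) ^ (n - j) * (j + 1) * ∑ᶠ F ∈ {F | IsFaceOfDim P F j}, VolZ j F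
      = (n + 1 : ℝ) * (sI v Finset.univ : ℝ) +
          ∑ I ∈ (Finset.univ : Finset (Fin (n + 1))).powerset.filter
              (fun I => I.card = n), (sI v I : ℝ)) ∧
    ((∑ j ∈ Finset.range (n + 1),
        (-1 : ℝ) ^ (n - j) * (j + 1) * ∑ᶠ F ∈ {F | IsFaceOfDim P F j}, VolZ j F) = 0 ↔
      ∀ I : Finset (Fin (n + 1)), n ≤ I.card → sI v I = 0) := by
  classical
  have htot : affineSpan ℝ (Set.range fun i => latt (v i)) = ⊤ := by
    rw [← hfull, hP, affineSpan_convexHull]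
  let b : AffineBasis (Fin (n + 1)) ℝ (Fin n → ℝ) := ⟨fun i => latt (v i), hind, htot⟩
  have hb : ∀ i, b i = latt (v i) := fun _ => rfl
  have hPb : P = convexHull ℝ (Set.range b) := hP
  have hface := isFaceOfDim_convexHull_range_iff b
  rw [← hPb] at hface
  let f : Finset (Fin (n + 1)) → ℝ := fun J => VolZ (J.card - 1) (convexHull ℝ (b '' J))
  have hf : ∀ J : Finset (Fin (n + 1)), J.Nonempty → f J = ∑ I ∈ J.powerset, (sI v I : ℝ) := by
    intro J hJ
    obtain ⟨j, hj⟩ : ∃ j, J.card = j + 1 :=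
      Nat.exists_eq_succ_of_ne_zero (Finset.card_pos.2 hJ).ne'
    let e : Fin (j + 1) ↪ Fin (n + 1) := (J.orderEmbOfFin hj).toEmbedding
    have hmap : Finset.univ.map e = J := J.map_orderEmbOfFin_univ hj
    have hrange : b '' J = Set.range fun k => latt (v (e k)) := by
      rw [← hmap, Finset.coe_map, Finset.coe_univ, Set.image_univ, ← Set.range_comp]
      rfl
    obtain ⟨φ, hφ, hvol, hfin⟩ :=
      exists_unimodularParam (fun k => v (e k)) (hind.comp_embedding e)
    rw [← hrange] at hφ hvol
    have h1 : f J = VolZ j (convexHull ℝ (b '' J)) := by simp [f, hj]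
    rw [h1, hVolZ j _ ((hface _ _).2 ⟨J, hj, rfl⟩) φ hφ, hvol, ← sum_sI_powerset_map v hind e hfin,
      hmap, Nat.cast_sum]
  have hsum : ∀ j, ∑ᶠ F ∈ {F | IsFaceOfDim P F j}, VolZ j F =
      ∑ J ∈ Finset.univ.filter (fun J : Finset (Fin (n + 1)) => J.card = j + 1), f J := by
    intro j
    have hset : {F | IsFaceOfDim P F j} =
        (fun J : Finset (Fin (n + 1)) => convexHull ℝ (b '' (J : Set (Fin (n + 1))))) ''
          (Finset.univ.filter fun J : Finset (Fin (n + 1)) => J.card = j + 1) := by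
      ext F
      simp [hface]
    rw [hset, finsum_mem_image (convexHull_image_injective b).injOn, finsum_mem_coe_finset]
    refine Finset.sum_congr rfl fun J hJ => ?_
    simp [f, (Finset.mem_filter.1 hJ).2]
  have hmain := alternating_sum_faces_eq f (fun I => (sI v I : ℝ)) hf
  simp_rw [hsum]
  refine ⟨hmain, ?_⟩
  rw [hmain, add_eq_zero_iff_of_nonneg (by positivity)
    (Finset.sum_nonneg fun I _ => Nat.cast_nonneg _), mul_eq_zero,
    or_iff_right (by positivity), Finset.sum_eq_zero_iff_of_nonneg fun I _ => Nat.cast_nonneg _]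
  constructor
  · rintro ⟨h1, h2⟩ I hI
    rcases hI.eq_or_lt with h | h
    · exact_mod_cast h2 I (by simp [h.symm])
    · have hle := Finset.card_le_univ I
      have hIu : I = Finset.univ := by
        rw [← Finset.card_eq_iff_eq_univ]
        simp only [Fintype.card_fin] at hle ⊢
        omega
      rw [hIu]; exact_mod_cast h1
  · intro h
    refine ⟨by rw [h _ (by simp), Nat.cast_zero], fun I hI => ?_⟩
    rw [h I (Finset.mem_filter.1 hI).2.ge, Nat.cast_zero]
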